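/- arXiv:1103.0995 — 2 statements merged into one kernel-verified Lean document; each statement's English description precedes it below -/
import Mathlib

section
/- Let A be a real m×n matrix of rank ρ and let k be an integer with 1 ≤ k < ρ. For every integer r with k < r ≤ n there exists a matrix C ∈ R^{m×r} whose columns are r columns of A such that ‖A − Π²_{C,k}(A)‖₂ ≤ ‖A − A_k‖₂ + ((1 + √(n/r)) / (1 − √(k/r))) · ‖A − A_k‖₂. -/
open Matrix MeasureTheory

noncomputable def frobSq {m n : Type*} [Fintype m] [Fintype n] (A : Matrix m n ℝ) : ℝ :=
  ∑ i, ∑ j, A i j ^ 2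

noncomputable def spec {m n : Type*} [Fintype m] [Fintype n] [DecidableEq n]
    (A : Matrix m n ℝ) : ℝ :=
  ‖LinearMap.toContinuousLinearMap (Matrix.toEuclideanLin A)‖

noncomputable def specErr {m n : Type*} [Fintype m] [Fintype n] [DecidableEq n]
    (A : Matrix m n ℝ) (k : ℕ) : ℝ :=
  sInf {e : ℝ | ∃ X : Matrix m n ℝ, X.rank ≤ k ∧ e = spec (A - X)}

noncomputable def frobSqErr {m n : Type*} [Fintype m] [Fintype n]
    (A : Matrix m n ℝ) (k : ℕ) : ℝ :=
  sInf {e : ℝ | ∃ X : Matrix m n ℝ, X.rank ≤ k ∧ e = frobSq (A - X)}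

noncomputable def specErrIn {m n r : Type*} [Fintype m] [Fintype n] [DecidableEq n]
    [Fintype r] (A : Matrix m n ℝ) (C : Matrix m r ℝ) (k : ℕ) : ℝ :=
  sInf {e : ℝ | ∃ X : Matrix m n ℝ, X.rank ≤ k ∧
    LinearMap.range X.mulVecLin ≤ LinearMap.range C.mulVecLin ∧ e = spec (A - X)}

noncomputable def frobSqErrIn {m n r : Type*} [Fintype m] [Fintype n] [Fintype r]
    (A : Matrix m n ℝ) (C : Matrix m r ℝ) (k : ℕ) : ℝ :=
  sInf {e : ℝ | ∃ X : Matrix m n ℝ, X.rank ≤ k ∧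
    LinearMap.range X.mulVecLin ≤ LinearMap.range C.mulVecLin ∧ e = frobSq (A - X)}

def IsMoorePenrose {m n : Type*} [Fintype m] [Fintype n]
    (M : Matrix m n ℝ) (P : Matrix n m ℝ) : Prop :=
  M * P * M = M ∧ P * M * P = P ∧ (M * P)ᵀ = M * P ∧ (P * M)ᵀ = P * M

lemma Matrix.PosDef.of_sub_smul_one {κ : Type*} [Fintype κ] [DecidableEq κ] {B : Matrix κ κ ℝ}
    {l : ℝ} (hB : (B - l • 1).PosDef) (hl : 0 ≤ l) : B.PosDef := by
  have := hB.add_posSemidef (PosSemidef.one.smul hl)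
  rwa [sub_add_cancel] at this

lemma one_add_sqrt_div_one_sub_sqrt_nonneg {n k r : ℕ} (hkr : k ≤ r) :
    0 ≤ (1 + √((n : ℝ) / r)) / (1 - √((k : ℝ) / r)) := by
  refine div_nonneg (by positivity) (sub_nonneg.2 (Real.sqrt_le_one.2 ?_))
  exact div_le_one_of_le₀ (by exact_mod_cast hkr) (by positivity)

/-- Scalar form of the lower barrier estimate. -/
lemma sum_inv_barrier {κ : Type*} [Fintype κ] (y : κ → ℝ) (hy : ∀ i, 1 < y i)
    (h : ∑ i, (y i)⁻¹ ≤ 1) :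
    (∑ i, (y i - 1)⁻¹ - ∑ i, (y i)⁻¹) * (1 + (∑ i, (y i - 1)⁻¹ - ∑ i, (y i)⁻¹)) ≤
      ∑ i, (y i - 1)⁻¹ * (y i - 1)⁻¹ := by
  have e1 : ∀ i, (y i - 1)⁻¹ - (y i)⁻¹ = (y i)⁻¹ * (y i - 1)⁻¹ := fun i => by
    have h1 : y i - 1 ≠ 0 := by linarith [hy i]
    have h2 : y i ≠ 0 := by linarith [hy i]
    field_simp
    ring
  have hD : ∑ i, (y i - 1)⁻¹ - ∑ i, (y i)⁻¹ = ∑ i, (y i)⁻¹ * (y i - 1)⁻¹ := by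
    rw [← Finset.sum_sub_distrib]
    exact Finset.sum_congr rfl fun i _ => e1 i
  have hS : ∑ i, (y i - 1)⁻¹ * (y i - 1)⁻¹ =
      ∑ i, (y i)⁻¹ * (y i - 1)⁻¹ + ∑ i, (y i)⁻¹ * (y i - 1)⁻¹ ^ 2 := by
    rw [← Finset.sum_add_distrib]
    refine Finset.sum_congr rfl fun i _ => ?_
    linear_combination (y i - 1)⁻¹ * e1 i
  have hpos : ∀ i, 0 < (y i)⁻¹ := fun i => inv_pos.2 (by linarith [hy i])
  have hCS : (∑ i, (y i)⁻¹ * (y i - 1)⁻¹) ^ 2 ≤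
      (∑ i, (y i)⁻¹) * ∑ i, (y i)⁻¹ * (y i - 1)⁻¹ ^ 2 :=
    Finset.sum_sq_le_sum_mul_sum_of_sq_le_mul _ (fun i _ => (hpos i).le)
      (fun i _ => mul_nonneg (hpos i).le (sq_nonneg _)) (fun i _ => le_of_eq (by ring))
  have hT : 0 ≤ ∑ i, (y i)⁻¹ * (y i - 1)⁻¹ ^ 2 :=
    Finset.sum_nonneg fun i _ => mul_nonneg (hpos i).le (sq_nonneg _)
  rw [hD, hS]
  nlinarith

/-- Moving the lower barrier by one keeps it below the spectrum, with a quantitative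
estimate on the change of the potential `tr P⁻¹`. -/
lemma Matrix.PosDef.lower_barrier {κ : Type*} [Fintype κ] [DecidableEq κ] [Nonempty κ]
    {P : Matrix κ κ ℝ} (hP : P.PosDef) (h : P⁻¹.trace < 1) :
    (P - 1).PosDef ∧ 0 < (P - 1)⁻¹.trace - P⁻¹.trace ∧
      ((P - 1)⁻¹.trace - P⁻¹.trace) * (1 + ((P - 1)⁻¹.trace - P⁻¹.trace)) ≤
        ((P - 1)⁻¹ * (P - 1)⁻¹).trace := by
  set y := hP.1.eigenvalues
  set φ := Unitary.conjStarAlgAut ℝ (Matrix κ κ ℝ) hP.1.eigenvectorUnitary with hφ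
  have htr : ∀ X, (φ X).trace = X.trace := fun X => by
    rw [hφ, Unitary.conjStarAlgAut_apply, Matrix.trace_mul_cycle, Unitary.coe_star_mul_self,
      one_mul]
  have hPy : P = φ (diagonal y) := hP.1.spectral_theorem
  have hinv : ∀ d : κ → ℝ, (∀ i, d i ≠ 0) → (φ (diagonal d))⁻¹ = φ (diagonal fun i => (d i)⁻¹) :=
    fun d hd => by
      refine Matrix.inv_eq_right_inv ?_
      rw [← map_mul, diagonal_mul_diagonal]
      simp [hd]
  have hP1 : P - 1 = φ (diagonal fun i => y i - 1) := by
    rw [hPy, ← map_one φ, ← map_sub, ← diagonal_one, diagonal_sub]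
  have hy0 : ∀ i, 0 < y i := hP.eigenvalues_pos
  have hPi : P⁻¹ = φ (diagonal fun i => (y i)⁻¹) := by
    rw [← hinv y fun i => (hy0 i).ne', ← hPy]
  have htP : P⁻¹.trace = ∑ i, (y i)⁻¹ := by rw [hPi, htr, trace_diagonal]
  have hy1 : ∀ i, 1 < y i := fun i => by
    have : (y i)⁻¹ < 1 := lt_of_le_of_lt
      (Finset.single_le_sum (f := fun i => (y i)⁻¹) (fun j _ => (inv_pos.2 (hy0 j)).le)
        (Finset.mem_univ i)) (htP ▸ h)
    exact (inv_lt_one₀ (hy0 i)).1 this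
  have hQi : (P - 1)⁻¹ = φ (diagonal fun i => (y i - 1)⁻¹) := by
    rw [hP1, hinv _ fun i => (sub_pos.2 (hy1 i)).ne']
  have htQ : (P - 1)⁻¹.trace = ∑ i, (y i - 1)⁻¹ := by rw [hQi, htr, trace_diagonal]
  refine ⟨?_, ?_, ?_⟩
  · rw [hP1, hφ, Unitary.conjStarAlgAut_apply,
      Matrix.IsUnit.posDef_star_right_conjugate_iff (Unitary.isUnit_coe), posDef_diagonal_iff]
    exact fun i => sub_pos.2 (hy1 i)
  · rw [htP, htQ, sub_pos]
    refine Finset.sum_lt_sum_of_nonempty Finset.univ_nonempty fun i _ => ?_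
    exact inv_strictAnti₀ (sub_pos.2 (hy1 i)) (by linarith)
  · have : ((P - 1)⁻¹ * (P - 1)⁻¹).trace = ∑ i, (y i - 1)⁻¹ * (y i - 1)⁻¹ := by
      rw [hQi, ← map_mul, htr, diagonal_mul_diagonal, trace_diagonal]
    rw [htP, htQ, this]
    exact sum_inv_barrier y hy1 (htP ▸ h.le)

/-- Rank-one update of the potential `tr L⁻¹` (Sherman–Morrison). -/
lemma Matrix.PosDef.trace_inv_add_smul_vecMulVec {κ : Type*} [Fintype κ] [DecidableEq κ]
    {L : Matrix κ κ ℝ} (hL : L.PosDef) (v : κ → ℝ) {t : ℝ} (ht : 0 ≤ t) :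
    (L + t • vecMulVec v v)⁻¹.trace =
      L⁻¹.trace - t * (v ⬝ᵥ (L⁻¹ * L⁻¹) *ᵥ v) / (1 + t * (v ⬝ᵥ L⁻¹ *ᵥ v)) := by
  set q := v ⬝ᵥ L⁻¹ *ᵥ v with hq
  have hq0 : 0 ≤ q := by simpa using hL.inv.posSemidef.dotProduct_mulVec_nonneg v
  have h1 : 1 + t * q ≠ 0 := by positivity
  have hu : L * L⁻¹ = 1 := Matrix.mul_nonsing_inv _ ((Matrix.isUnit_iff_isUnit_det _).1 hL.isUnit)
  have hq' : vecMulVec v v * L⁻¹ * vecMulVec v v = q • vecMulVec v v := by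
    rw [vecMulVec_mul, vecMulVec_mul_vecMulVec, ← dotProduct_mulVec, vecMulVec_smul]
  have hinv : (L + t • vecMulVec v v)⁻¹ =
      L⁻¹ - (t / (1 + t * q)) • (L⁻¹ * vecMulVec v v * L⁻¹) := by
    refine Matrix.inv_eq_right_inv ?_
    have e : L * (L⁻¹ * vecMulVec v v * L⁻¹) = vecMulVec v v * L⁻¹ := by
      rw [← Matrix.mul_assoc, ← Matrix.mul_assoc, hu, Matrix.one_mul]
    have e2 : vecMulVec v v * (L⁻¹ * vecMulVec v v * L⁻¹) = q • (vecMulVec v v * L⁻¹) := by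
      rw [← Matrix.mul_assoc, ← Matrix.mul_assoc, hq', Matrix.smul_mul]
    have hc : ∀ W : Matrix κ κ ℝ,
        t • W - (t / (1 + t * q)) • (W + t • q • W) = (0 : ℝ) • W := fun W => by
      have : t - t / (1 + t * q) * (1 + t * q) = 0 := by field_simp; ring
      rw [← this]
      module
    rw [Matrix.mul_sub, Matrix.add_mul, hu, Matrix.mul_smul, Matrix.add_mul, e, Matrix.smul_mul,
      Matrix.smul_mul, e2, add_sub_assoc, hc, zero_smul, add_zero]
  rw [hinv, trace_sub, trace_smul, Matrix.trace_mul_cycle, ← Matrix.trace_mul_comm, vecMulVec_mul,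
    trace_vecMulVec, smul_eq_mul, dotProduct_comm, ← dotProduct_mulVec]
  ring

lemma Matrix.sum_dotProduct_mulVec_row {ι κ : Type*} [Fintype ι] [Fintype κ] [DecidableEq κ]
    {V : Matrix ι κ ℝ} (hV : Vᵀ * V = 1) (Q : Matrix κ κ ℝ) :
    ∑ i, V i ⬝ᵥ Q *ᵥ V i = Q.trace := by
  have : Q.trace = (V * Q * Vᵀ).trace := by
    rw [Matrix.trace_mul_cycle, hV, Matrix.one_mul]
  rw [this, Matrix.trace]
  refine Finset.sum_congr rfl fun i _ => ?_
  rw [diag_apply, Matrix.mul_assoc, mul_apply_eq_vecMul, dotProduct_mulVec,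
    ← dotProduct_mulVec]
  rfl

lemma Matrix.transpose_mul_diagonal_add_single_mul {ι κ : Type*} [Fintype ι] [DecidableEq ι]
    (V : Matrix ι κ ℝ) (a : ι → ℝ) (i : ι) (t : ℝ) :
    Vᵀ * diagonal (a + Pi.single i t) * V =
      Vᵀ * diagonal a * V + t • vecMulVec (V i) (V i) := by
  rw [show diagonal (a + Pi.single i t) = diagonal a + diagonal (Pi.single i t) from
    (diagonal_add _ _).symm, Matrix.mul_add, Matrix.add_mul]
  congr 1
  ext p q
  rw [Matrix.mul_apply, Finset.sum_eq_single i]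
  · simp [mul_diagonal, vecMulVec_apply]
    ring
  · intro j _ hj
    simp [mul_diagonal, hj]
  · simp

/-- A coordinate may be increased by `t` while the upper barrier moves by `δ`, provided `t⁻¹`
is at least the stated threshold. -/
lemma upper_barrier_update {ι : Type*} [Fintype ι] [DecidableEq ι] [Nonempty ι] {a : ι → ℝ}
    {u δ : ℝ} (hδ : 0 < δ) (ha : ∀ j, a j < u) {D : ℝ}
    (hD : D = ∑ j, (u - a j)⁻¹ - ∑ j, (u + δ - a j)⁻¹) (hD0 : 0 < D) {i : ι} {t : ℝ}
    (ht : t = ((u + δ - a i)⁻¹ + ((u + δ - a i)⁻¹) ^ 2 / D)⁻¹) :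
    (∀ j, (a + Pi.single i t : ι → ℝ) j < u + δ) ∧
      ∑ j, (u + δ - (a + Pi.single i t : ι → ℝ) j)⁻¹ = ∑ j, (u - a j)⁻¹ := by
  set x := u + δ - a i with hx
  have hx0 : 0 < x := by linarith [ha i]
  have hxt : x - t = (x⁻¹ + D)⁻¹ := by
    rw [ht]
    field_simp
    ring
  have hxt0 : 0 < x - t := by rw [hxt]; positivity
  refine ⟨fun j => ?_, ?_⟩
  · rcases eq_or_ne j i with rfl | hj
    · simp only [Pi.add_apply, Pi.single_eq_same]
      linarith
    · simp only [Pi.add_apply, Pi.single_eq_of_ne hj]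
      linarith [ha j]
  · have : ∀ j, (u + δ - (a + Pi.single i t : ι → ℝ) j)⁻¹ =
        (u + δ - a j)⁻¹ + (Pi.single i D : ι → ℝ) j := fun j => by
      rcases eq_or_ne j i with rfl | hj
      · simp only [Pi.add_apply, Pi.single_eq_same]
        rw [← sub_sub, ← hx, hxt, inv_inv]
      · simp [Pi.single_eq_of_ne hj]
    rw [Finset.sum_congr rfl fun j _ => this j, Finset.sum_add_distrib, Finset.sum_pi_single']
    simp [hD]

lemma sum_upper_barrier_le {ι : Type*} [Fintype ι] [Nonempty ι] {a : ι → ℝ}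
    {u δ : ℝ} (hδ : 0 < δ) (ha : ∀ j, a j < u) :
    0 < ∑ j, (u - a j)⁻¹ - ∑ j, (u + δ - a j)⁻¹ ∧
      ∑ i, ((u + δ - a i)⁻¹ + ((u + δ - a i)⁻¹) ^ 2 /
        (∑ j, (u - a j)⁻¹ - ∑ j, (u + δ - a j)⁻¹)) ≤ ∑ j, (u - a j)⁻¹ + 1 / δ := by
  set D := ∑ j, (u - a j)⁻¹ - ∑ j, (u + δ - a j)⁻¹ with hD
  have hlt : ∀ j, (u + δ - a j)⁻¹ < (u - a j)⁻¹ := fun j =>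
    inv_strictAnti₀ (by linarith [ha j]) (by linarith)
  have hD0 : 0 < D := sub_pos.2 (Finset.sum_lt_sum_of_nonempty Finset.univ_nonempty
    fun j _ => hlt j)
  refine ⟨hD0, ?_⟩
  have hsq : δ * ∑ i, ((u + δ - a i)⁻¹) ^ 2 ≤ D := by
    rw [hD, ← Finset.sum_sub_distrib, Finset.mul_sum]
    refine Finset.sum_le_sum fun j _ => ?_
    have h1 : 0 < u - a j := by linarith [ha j]
    have h2 : 0 < u + δ - a j := by linarith
    have e : (u - a j)⁻¹ - (u + δ - a j)⁻¹ = δ * ((u + δ - a j)⁻¹ * (u - a j)⁻¹) := by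
      field_simp
      ring
    rw [e, sq]
    have := (hlt j).le
    gcongr
  rw [Finset.sum_add_distrib, ← Finset.sum_div]
  refine add_le_add (Finset.sum_le_sum fun j _ => (hlt j).le) ?_
  rw [div_le_div_iff₀ hD0 hδ]
  linarith

/-- One step of the two-barrier argument of Batson, Spielman and Srivastava. -/
lemma exists_barrier_step {ι κ : Type*} [Fintype ι] [DecidableEq ι] [Nonempty ι]
    [Fintype κ] [DecidableEq κ] [Nonempty κ] {V : Matrix ι κ ℝ} (hV : Vᵀ * V = 1)
    {a : ι → ℝ} {u l δ φu φl : ℝ} (hδ : 0 < δ) (hφ : 1 / δ + φu ≤ 1 - φl) (hφl : φl < 1)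
    (ha : ∀ j, a j < u) (hu : ∑ j, (u - a j)⁻¹ ≤ φu)
    (hM : (Vᵀ * diagonal a * V - l • 1).PosDef)
    (hl : (Vᵀ * diagonal a * V - l • 1)⁻¹.trace ≤ φl) :
    ∃ (i : ι) (t : ℝ), 0 < t ∧ (∀ j, (a + Pi.single i t : ι → ℝ) j < u + δ) ∧
      ∑ j, (u + δ - (a + Pi.single i t : ι → ℝ) j)⁻¹ ≤ φu ∧
      (Vᵀ * diagonal (a + Pi.single i t) * V - (l + 1) • 1).PosDef ∧
      (Vᵀ * diagonal (a + Pi.single i t) * V - (l + 1) • 1)⁻¹.trace ≤ φl := by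
  set P := Vᵀ * diagonal a * V - l • 1 with hP
  obtain ⟨hL, hD0, hDle⟩ := hM.lower_barrier (hl.trans_lt hφl)
  set L := P - 1 with hLdef
  set D := L⁻¹.trace - P⁻¹.trace with hD
  obtain ⟨hE0, hE⟩ := sum_upper_barrier_le hδ ha
  set E := ∑ j, (u - a j)⁻¹ - ∑ j, (u + δ - a j)⁻¹ with hEdef
  have hlow : 1 - P⁻¹.trace ≤
      ∑ i, (V i ⬝ᵥ (L⁻¹ * L⁻¹) *ᵥ V i / D - V i ⬝ᵥ L⁻¹ *ᵥ V i) := by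
    rw [Finset.sum_sub_distrib, ← Finset.sum_div, sum_dotProduct_mulVec_row hV,
      sum_dotProduct_mulVec_row hV]
    have : 1 + D ≤ (L⁻¹ * L⁻¹).trace / D := by
      rw [le_div_iff₀ hD0]
      linarith
    linarith
  obtain ⟨i, -, hi⟩ := Finset.exists_le_of_sum_le Finset.univ_nonempty
    ((hE.trans (by linarith : _ ≤ 1 - P⁻¹.trace)).trans hlow)
  set c := (u + δ - a i)⁻¹ + ((u + δ - a i)⁻¹) ^ 2 / E with hc
  have hx0 : 0 < u + δ - a i := by linarith [ha i]
  have hc0 : 0 < c := by positivity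
  obtain ⟨h1, h2⟩ := upper_barrier_update (i := i) hδ ha hEdef hE0 (hc ▸ rfl : c⁻¹ = _)
  have hMt : Vᵀ * diagonal (a + Pi.single i c⁻¹) * V - (l + 1) • 1 =
      L + c⁻¹ • vecMulVec (V i) (V i) := by
    rw [transpose_mul_diagonal_add_single_mul, hLdef, hP, add_smul, one_smul]
    abel
  refine ⟨i, c⁻¹, inv_pos.2 hc0, h1, h2.trans_le hu, ?_, ?_⟩
  · rw [hMt]
    refine hL.add_posSemidef (PosSemidef.smul ?_ (inv_pos.2 hc0).le)
    simpa using posSemidef_vecMulVec_self_star (V i)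
  · rw [hMt, hL.trace_inv_add_smul_vecMulVec _ (inv_pos.2 hc0).le]
    set q := V i ⬝ᵥ L⁻¹ *ᵥ V i with hq
    have hq0 : 0 ≤ q := by simpa using hL.inv.posSemidef.dotProduct_mulVec_nonneg (V i)
    set s := V i ⬝ᵥ (L⁻¹ * L⁻¹) *ᵥ V i
    have hs : D * (c + q) ≤ s := by
      have : c + q ≤ s / D := by linarith
      rw [le_div_iff₀ hD0] at this
      linarith
    have : D ≤ c⁻¹ * s / (1 + c⁻¹ * q) := by
      have e : c⁻¹ * s / (1 + c⁻¹ * q) = s / (c + q) := by field_simp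
      rwa [e, le_div_iff₀ (by positivity)]
    linarith

lemma exists_weights_of_barriers {ι κ : Type*} [Fintype ι] [DecidableEq ι] [Nonempty ι]
    [Fintype κ] [DecidableEq κ] [Nonempty κ] {V : Matrix ι κ ℝ} (hV : Vᵀ * V = 1)
    {u l δ : ℝ} (hδ : 0 < δ) (hu : 0 < u) (hl : 0 < l) (hlκ : Fintype.card κ / l < 1)
    (hφ : 1 / δ + Fintype.card ι / u ≤ 1 - Fintype.card κ / l) (r : ℕ) :
    ∃ a : ι → ℝ, 0 ≤ a ∧ (Finset.univ.filter (a · ≠ 0)).card ≤ r ∧ (∀ j, a j < u + r * δ) ∧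
      (Vᵀ * diagonal a * V - (r - l) • 1).PosDef := by
  suffices ∃ a : ι → ℝ, 0 ≤ a ∧ (Finset.univ.filter (a · ≠ 0)).card ≤ r ∧
      (∀ j, a j < u + r * δ) ∧ ∑ j, (u + r * δ - a j)⁻¹ ≤ Fintype.card ι / u ∧
      (Vᵀ * diagonal a * V - (r - l) • 1).PosDef ∧
      (Vᵀ * diagonal a * V - (r - l) • 1)⁻¹.trace ≤ Fintype.card κ / l by
    obtain ⟨a, h1, h2, h3, -, h4, -⟩ := this
    exact ⟨a, h1, h2, h3, h4⟩
  induction r with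
  | zero =>
    have e : Vᵀ * diagonal (0 : ι → ℝ) * V - ((0 : ℕ) - l) • 1 = l • (1 : Matrix κ κ ℝ) := by
      simp
    refine ⟨0, le_rfl, by simp, by simpa using hu, by simp [div_eq_mul_inv], ?_, ?_⟩
    · rw [e]
      exact PosDef.one.smul hl
    · rw [e, Matrix.inv_eq_right_inv (B := l⁻¹ • 1) (by simp [smul_smul, hl.ne'])]
      simp [div_eq_inv_mul]
  | succ r ih =>
    obtain ⟨a, h0, hcard, h1, h2, h3, h4⟩ := ih
    obtain ⟨i, t, ht, g1, g2, g3, g4⟩ := exists_barrier_step hV hδ hφ hlκ h1 h2 h3 h4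
    have e1 : u + ((r + 1 : ℕ) : ℝ) * δ = u + r * δ + δ := by push_cast; ring
    have e2 : ((r + 1 : ℕ) : ℝ) - l = r - l + 1 := by push_cast; ring
    refine ⟨a + Pi.single i t, add_nonneg h0 (Pi.single_nonneg.2 ht.le), ?_, by rwa [e1],
      by rwa [e1], by rwa [e2], by rwa [e2]⟩
    refine (Finset.card_le_card (t := insert i (Finset.univ.filter (a · ≠ 0))) ?_).trans
      ((Finset.card_insert_le _ _).trans (by lia))
    intro j hj
    by_cases hji : j = i
    · simp [hji]
    · simpa [hji] using hj

/-- Deterministic weighted row selection with spectral control (dual set sparsification for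
the standard basis). -/
lemma exists_sparse_weights {n k r : ℕ} (hk1 : 1 ≤ k) (hkr : k < r) (hrn : r ≤ n)
    {V : Matrix (Fin n) (Fin k) ℝ} (hV : Vᵀ * V = 1) :
    ∃ (a : Fin n → ℝ) (l u : ℝ), 0 < l ∧ 0 ≤ u ∧
      u / l = ((1 + √((n : ℝ) / r)) / (1 - √((k : ℝ) / r))) ^ 2 ∧
      0 ≤ a ∧ (Finset.univ.filter (a · ≠ 0)).card ≤ r ∧ (∀ j, a j ≤ u) ∧
      (Vᵀ * diagonal a * V - l • 1).PosDef := by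
  have : NeZero k := ⟨by lia⟩
  have : NeZero n := ⟨by lia⟩
  rw [Real.sqrt_div (by positivity), Real.sqrt_div (by positivity)]
  set α := √(k : ℝ)
  set β := √(n : ℝ)
  set ρ := √(r : ℝ)
  have hα2 : (k : ℝ) = α ^ 2 := (Real.sq_sqrt (by positivity)).symm
  have hβ2 : (n : ℝ) = β ^ 2 := (Real.sq_sqrt (by positivity)).symm
  have hρ2 : (r : ℝ) = ρ ^ 2 := (Real.sq_sqrt (by positivity)).symm
  have hα : 0 < α := Real.sqrt_pos.2 (by exact_mod_cast hk1)
  have hβ : 0 < β := Real.sqrt_pos.2 (by exact_mod_cast (by lia : 0 < n))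
  have hαρ : α < ρ := Real.sqrt_lt_sqrt (by positivity) (by exact_mod_cast hkr)
  have hρ : 0 < ρ := hα.trans hαρ
  have hd : 0 < 1 - α / ρ := sub_pos.2 ((div_lt_one hρ).2 hαρ)
  set d := 1 - α / ρ with hddef
  set δ := (1 + β / ρ) / d with hδdef
  have hδ : 0 < δ := by positivity
  have hκ : (Fintype.card (Fin k) : ℝ) / (ρ * α) = 1 - d := by
    rw [Fintype.card_fin, hα2, hddef]
    field_simp
    ring
  have hι : 1 / δ + (Fintype.card (Fin n) : ℝ) / (δ * (β * ρ)) = d := by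
    rw [Fintype.card_fin, hβ2, hδdef]
    field_simp
  have hρd : (r : ℝ) - ρ * α = ρ ^ 2 * d := by
    rw [hρ2, hddef]
    field_simp
  obtain ⟨a, h0, hc, hu, hP⟩ := exists_weights_of_barriers (u := δ * (β * ρ)) (l := ρ * α) hV hδ
    (by positivity) (by positivity) (by rw [hκ]; linarith) (by rw [hι, hκ]; linarith) r
  refine ⟨a, r - ρ * α, δ * (β * ρ) + r * δ, by rw [hρd]; positivity, by positivity, ?_, h0, hc,
    fun j => (hu j).le, hP⟩
  rw [hρd, hρ2, hδdef]
  field_simp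
  ring

lemma Matrix.exists_orthonormal_cols_of_rank_le {m n k : ℕ} (X : Matrix (Fin m) (Fin n) ℝ)
    (hX : X.rank ≤ k) (hkn : k ≤ n) :
    ∃ V : Matrix (Fin n) (Fin k) ℝ, Vᵀ * V = 1 ∧ X * V * Vᵀ = X := by
  have hH : (Xᵀ * X).IsHermitian := by simpa using isHermitian_conjTranspose_mul_self X
  have hcard : (Finset.univ.filter (hH.eigenvalues · ≠ 0)).card ≤ k := by
    rw [← Fintype.card_subtype, ← hH.rank_eq_card_non_zero_eigs, rank_transpose_mul_self]
    exact hX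
  obtain ⟨S, hS, hSk⟩ := Finset.exists_superset_card_eq hcard (by simpa using hkn)
  set e := S.orderEmbOfFin hSk
  set U : Matrix (Fin n) (Fin n) ℝ := (hH.eigenvectorUnitary : Matrix (Fin n) (Fin n) ℝ)
  have hUU : Uᵀ * U = 1 := by
    simpa [star_eq_conjTranspose] using Unitary.coe_star_mul_self hH.eigenvectorUnitary
  have hUU' : U * Uᵀ = 1 := mul_eq_one_comm.1 hUU
  have hXU : ∀ i, ∀ j ∉ S, (X * U) i j = 0 := fun i j hj => by
    have hj0 : hH.eigenvalues j = 0 := by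
      by_contra h
      exact hj (hS (by simpa using h))
    have h0 : (Xᵀ * X) *ᵥ (hH.eigenvectorBasis j).ofLp = 0 := by
      rw [hH.mulVec_eigenvectorBasis, hj0, zero_smul]
    have h1 : X *ᵥ (hH.eigenvectorBasis j).ofLp = 0 := by
      have := (conjTranspose_mul_self_mulVec_eq_zero X (hH.eigenvectorBasis j).ofLp).1
      exact this (by simpa using h0)
    exact congrFun h1 i
  refine ⟨U.submatrix id e, ?_, ?_⟩
  · ext p q
    have := congrFun (congrFun hUU (e p)) (e q)
    simpa [Matrix.mul_apply, Matrix.one_apply] using this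
  · have hmul : X * U.submatrix id e = (X * U).submatrix id e := rfl
    calc X * U.submatrix id e * (U.submatrix id e)ᵀ = (X * U) * Uᵀ := by
          rw [hmul]
          ext p q
          rw [Matrix.mul_apply, Matrix.mul_apply,
            ← Finset.sum_subset (Finset.subset_univ S) fun j _ hj => by rw [hXU p j hj, zero_mul]]
          have hSe : S = Finset.univ.map e.toEmbedding := by simp [e]
          conv_rhs => rw [hSe, Finset.sum_map]
          rfl
      _ = X := by rw [Matrix.mul_assoc, hUU', Matrix.mul_one]

open scoped Matrix.Norms.L2Operator in
/-- Norm bound for the weighted left inverse of `Vᵀ` obtained from spectrally controlled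
weights. -/
lemma Matrix.l2_opNorm_weighted_inverse_le {n k : ℕ} {V : Matrix (Fin n) (Fin k) ℝ}
    {a : Fin n → ℝ} {l u : ℝ} (hl : 0 < l) (ha : 0 ≤ a) (hau : ∀ j, a j ≤ u) (hu : 0 ≤ u)
    (hB : (Vᵀ * diagonal a * V - l • 1).PosDef) :
    ‖diagonal a * V * (Vᵀ * diagonal a * V)⁻¹‖ ≤ √(u / l) := by
  set B := Vᵀ * diagonal a * V with hBdef
  have hBpos : B.PosDef := hB.of_sub_smul_one hl.le
  have hBB : B * B⁻¹ = 1 := mul_nonsing_inv _ ((isUnit_iff_isUnit_det _).1 hBpos.isUnit)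
  rw [l2_opNorm_def]
  refine ContinuousLinearMap.opNorm_le_bound _ (Real.sqrt_nonneg _) fun x => ?_
  set y := B⁻¹ *ᵥ x.ofLp with hy
  have hBy : B *ᵥ y = x.ofLp := by rw [hy, mulVec_mulVec, hBB, one_mulVec]
  have hquad : y ⬝ᵥ B *ᵥ y = ∑ j, a j * (V *ᵥ y) j ^ 2 := by
    rw [hBdef, ← mulVec_mulVec, ← mulVec_mulVec, dotProduct_mulVec, vecMul_transpose, dotProduct]
    refine Finset.sum_congr rfl fun j _ => ?_
    rw [mulVec_diagonal]
    ring
  have hlow : l * (y ⬝ᵥ y) ≤ y ⬝ᵥ B *ᵥ y := by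
    have := hB.posSemidef.dotProduct_mulVec_nonneg y
    simp only [star_trivial, sub_mulVec, smul_mulVec, one_mulVec, dotProduct_sub,
      dotProduct_smul, smul_eq_mul] at this
    linarith
  have hlx : l * (y ⬝ᵥ B *ᵥ y) ≤ ‖x‖ ^ 2 := by
    have hx : ‖x‖ ^ 2 = x.ofLp ⬝ᵥ x.ofLp := by
      rw [EuclideanSpace.real_norm_sq_eq]
      exact Finset.sum_congr rfl fun i _ => sq _
    have hsq : 0 ≤ (x.ofLp - l • y) ⬝ᵥ (x.ofLp - l • y) :=
      Finset.sum_nonneg fun i _ => mul_self_nonneg _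
    rw [hBy] at hlow ⊢
    simp only [dotProduct_sub, sub_dotProduct, dotProduct_smul, smul_dotProduct, smul_eq_mul,
      dotProduct_comm x.ofLp y] at hsq
    rw [hx]
    nlinarith
  have hT : ‖(toEuclideanLin (diagonal a * V * B⁻¹)).toContinuousLinearMap x‖ ^ 2 ≤
      u * (y ⬝ᵥ B *ᵥ y) := by
    rw [EuclideanSpace.real_norm_sq_eq, hquad, Finset.mul_sum]
    refine Finset.sum_le_sum fun j _ => ?_
    have e : ((toEuclideanLin (diagonal a * V * B⁻¹)).toContinuousLinearMap x).ofLp j =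
        a j * (V *ᵥ y) j := by
      rw [LinearMap.coe_toContinuousLinearMap', ofLp_toLpLin, toLin'_apply, Matrix.mul_assoc,
        ← mulVec_mulVec, ← mulVec_mulVec, mulVec_diagonal]
    rw [e, mul_pow, sq (a j), mul_assoc]
    exact mul_le_mul_of_nonneg_right (hau j) (mul_nonneg (ha j) (sq_nonneg _))
  refine le_of_sq_le_sq ?_ (by positivity)
  rw [mul_pow, Real.sq_sqrt (by positivity)]
  refine hT.trans ?_
  rw [div_mul_eq_mul_div, mul_div_assoc]
  refine mul_le_mul_of_nonneg_left ?_ hu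
  rw [le_div_iff₀ hl]
  linarith

open scoped Matrix.Norms.L2Operator in
lemma Matrix.l2_opNorm_transpose_le_one {n k : ℕ} {V : Matrix (Fin n) (Fin k) ℝ}
    (hV : Vᵀ * V = 1) : ‖Vᵀ‖ ≤ 1 := by
  have h : ‖Vᵀ‖ = ‖V‖ := by simpa using l2_opNorm_conjTranspose V
  have h1 : ‖(1 : Matrix (Fin k) (Fin k) ℝ)‖ ≤ 1 := by
    rw [← diagonal_one, l2_opNorm_diagonal]
    exact (pi_norm_le_iff_of_nonneg zero_le_one).2 fun _ => by simp
  have h2 : ‖V‖ * ‖V‖ ≤ 1 := by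
    rw [← l2_opNorm_conjTranspose_mul_self]
    simpa [hV] using h1
  rw [h]
  nlinarith [norm_nonneg V]

lemma Matrix.mulVec_mem_range_submatrix {m n r : ℕ} (A : Matrix (Fin m) (Fin n) ℝ)
    {f : Fin r → Fin n} (hf : Function.Injective f) {y : Fin n → ℝ}
    (hy : ∀ j ∉ Set.range f, y j = 0) :
    A *ᵥ y ∈ LinearMap.range (A.submatrix id f).mulVecLin := by
  refine ⟨y ∘ f, ?_⟩
  ext i
  simp only [mulVecLin_apply, mulVec, dotProduct, submatrix_apply, id, Function.comp]
  exact Fintype.sum_of_injective f hf _ _ (fun j hj => by rw [hy j hj, mul_zero]) fun _ => rfl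

open scoped Matrix.Norms.L2Operator in
/-- Any rank `k` approximation of `A` can be transferred to `r` suitable columns of `A`. -/
lemma exists_specErrIn_le {m n k r : ℕ} (A X : Matrix (Fin m) (Fin n) ℝ) (hk1 : 1 ≤ k)
    (hkr : k < r) (hrn : r ≤ n) (hX : X.rank ≤ k) :
    ∃ f : Fin r → Fin n, Function.Injective f ∧
      specErrIn A (A.submatrix id f) k ≤
        (1 + (1 + √((n : ℝ) / r)) / (1 - √((k : ℝ) / r))) * spec (A - X) := by
  obtain ⟨V, hV, hXV⟩ := X.exists_orthonormal_cols_of_rank_le hX (hkr.le.trans hrn)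
  obtain ⟨a, l, u, hl, hu, hul, ha, hcard, hau, hB⟩ := exists_sparse_weights hk1 hkr hrn hV
  have hc0 : 0 ≤ (1 + √((n : ℝ) / r)) / (1 - √((k : ℝ) / r)) := one_add_sqrt_div_one_sub_sqrt_nonneg hkr.le
  set c := (1 + √((n : ℝ) / r)) / (1 - √((k : ℝ) / r))
  have hT := l2_opNorm_weighted_inverse_le hl ha hau hu hB
  rw [hul, Real.sqrt_sq hc0] at hT
  have hBpos : (Vᵀ * diagonal a * V).PosDef := hB.of_sub_smul_one hl.le
  have hVT : Vᵀ * (diagonal a * V * (Vᵀ * diagonal a * V)⁻¹) = 1 := by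
    rw [← Matrix.mul_assoc, ← Matrix.mul_assoc]
    exact mul_nonsing_inv _ ((isUnit_iff_isUnit_det _).1 hBpos.isUnit)
  obtain ⟨S, hS, hSr⟩ := Finset.exists_superset_card_eq hcard (by simpa using hrn)
  set f := S.orderEmbOfFin hSr with hf
  refine ⟨f, f.injective, ?_⟩
  have hsupp : ∀ w : Fin k → ℝ, ∀ j ∉ Set.range f, (diagonal a *ᵥ (V *ᵥ w)) j = 0 :=
    fun w j hj => by
      have haj : a j = 0 := by
        by_contra h
        exact hj (by rw [hf, Finset.range_orderEmbOfFin]; exact hS (by simpa using h))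
      rw [mulVec_diagonal, haj, zero_mul]
  set T := diagonal a * V * (Vᵀ * diagonal a * V)⁻¹ with hTdef
  have hle : specErrIn A (A.submatrix id f) k ≤ spec (A - A * T * Vᵀ) := by
    refine csInf_le ⟨0, ?_⟩ ⟨A * T * Vᵀ, ?_, ?_, rfl⟩
    · rintro _ ⟨Y, -, -, rfl⟩
      exact norm_nonneg _
    · exact (rank_mul_le_left _ _).trans (rank_le_width _)
    · rintro _ ⟨x, rfl⟩
      rw [mulVecLin_apply, ← mulVec_mulVec, ← mulVec_mulVec, hTdef, ← mulVec_mulVec,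
        ← mulVec_mulVec]
      exact mulVec_mem_range_submatrix A f.injective (hsupp _)
  refine hle.trans ?_
  have hXT : X * T * Vᵀ = X := by
    conv_lhs => rw [← hXV]
    rw [Matrix.mul_assoc (X * V), hVT, Matrix.mul_one, hXV]
  have e : A - A * T * Vᵀ = (A - X) - (A - X) * T * Vᵀ := by
    rw [Matrix.sub_mul, Matrix.sub_mul, hXT]
    abel
  change ‖A - A * T * Vᵀ‖ ≤ (1 + c) * ‖A - X‖
  calc ‖A - A * T * Vᵀ‖ ≤ ‖A - X‖ + ‖(A - X) * T * Vᵀ‖ := by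
        rw [e]
        exact norm_sub_le _ _
    _ ≤ ‖A - X‖ + ‖A - X‖ * c * 1 := by
        gcongr
        refine (l2_opNorm_mul _ _).trans ?_
        gcongr
        · refine (l2_opNorm_mul _ _).trans ?_
          gcongr
        · exact l2_opNorm_transpose_le_one hV
    _ = (1 + c) * ‖A - X‖ := by ring

/-- **Deterministic spectral norm reconstruction using only the top `k` right singular
vectors** (Theorem 6 of Boutsidis–Drineas–Magdon-Ismail): for any real `m × n` matrix `A`
of rank `ρ`, any target rank `k` with `1 ≤ k < ρ`, and any `r` with `k < r ≤ n`, there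
exist `r` columns of `A` forming a matrix `C` such that
`‖A - Π²_{C,k}(A)‖₂ ≤ ‖A - A_k‖₂ + ((1 + √(n/r)) / (1 - √(k/r))) ‖A - A_k‖₂`. -/
theorem spectral_norm_column_reconstruction'
    {m n : ℕ} (A : Matrix (Fin m) (Fin n) ℝ) (k : ℕ)
    (hk1 : 1 ≤ k) (hk : k < A.rank) (r : ℕ) (hkr : k < r) (hrn : r ≤ n) :
    ∃ f : Fin r → Fin n, Function.Injective f ∧
      specErrIn A (A.submatrix id f) k ≤
        specErr A k +
          ((1 + Real.sqrt ((n : ℝ) / (r : ℝ))) / (1 - Real.sqrt ((k : ℝ) / (r : ℝ)))) *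
            specErr A k := by
  obtain ⟨f, hf, hmin⟩ := Set.exists_min_image {f : Fin r → Fin n | Function.Injective f}
    (fun f => specErrIn A (A.submatrix id f) k) (Set.toFinite _)
    ⟨Fin.castLE hrn, Fin.castLE_injective hrn⟩
  refine ⟨f, hf, ?_⟩
  set c := (1 + Real.sqrt ((n : ℝ) / (r : ℝ))) / (1 - Real.sqrt ((k : ℝ) / (r : ℝ)))
  have hc0 : 0 ≤ c := one_add_sqrt_div_one_sub_sqrt_nonneg hkr.le
  rw [← one_add_mul, mul_comm, ← div_le_iff₀ (by positivity)]
  refine le_csInf ⟨_, 0, by simp, rfl⟩ ?_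
  rintro _ ⟨X, hX, rfl⟩
  obtain ⟨g, hg, hgX⟩ := exists_specErrIn_le A X hk1 hkr hrn hX
  rw [div_le_iff₀ (by positivity), mul_comm]
  exact (hmin g hg).trans hgX
end

section
/- Let A ∈ R^{m×n} have rank ρ, let k be an integer with 2 ≤ k < ρ, let p ≥ 2 be an integer, and set r = k + p. Let R ∈ R^{n×r} be a random matrix whose entries are independent standard Gaussian random variables, and set Y = A R ∈ R^{m×r}. Then E[ min { ‖A − X‖_F² : X ∈ R^{m×n}, rank(X) ≤ k, column space of X contained in column space of Y } ] ≤ (1 + k/(p−1)) · ‖A − A_k‖_F². -/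
open Matrix MeasureTheory

open ProbabilityTheory

/-- The standard Gaussian measure on the coordinate space `ι → ℝ`. -/
noncomputable abbrev gaussianPi (ι : Type*) [Fintype ι] : Measure (ι → ℝ) :=
  Measure.pi fun _ => gaussianReal 0 1

lemma measurePreserving_orthonormalBasis_gaussianPi {ι n : Type*} [Fintype ι] [Fintype n]
    (b : OrthonormalBasis ι ℝ (EuclideanSpace ℝ n)) :
    MeasurePreserving (fun x : ι → ℝ => fun a => ∑ i, x i * b i a)
      (gaussianPi ι) (gaussianPi n) := by
  refine ⟨by fun_prop, ?_⟩
  have h := (map_pi_eq_stdGaussian (ι := n)).trans (stdGaussian_eq_map_pi_orthonormalBasis b)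
  have h2 := congrArg (Measure.map (WithLp.ofLp : EuclideanSpace ℝ n → n → ℝ)) h
  rw [Measure.map_map (by fun_prop) (by fun_prop),
    Measure.map_map (by fun_prop) (by fun_prop)] at h2
  have e1 : (WithLp.ofLp : EuclideanSpace ℝ n → n → ℝ) ∘ (WithLp.toLp 2) = id := by
    ext; simp
  rw [e1, Measure.map_id] at h2
  rw [gaussianPi, gaussianPi, h2]
  congr 1
  ext x a
  simp

lemma measurePreserving_curry_pi {ι κ : Type*} [Fintype ι] [Fintype κ] (μ : Measure ℝ)
    [IsProbabilityMeasure μ] :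
    MeasurePreserving (MeasurableEquiv.curry ι κ ℝ)
      (Measure.pi fun _ => μ) (Measure.pi fun _ => Measure.pi fun _ => μ) := by
  refine ⟨by fun_prop, ?_⟩
  have := Measure.infinitePi_map_curry (fun (_ : ι) (_ : κ) => μ)
  simpa only [Measure.infinitePi_eq_pi] using this

lemma measurePreserving_swap_pi {ι κ : Type*} [Fintype ι] [Fintype κ] (μ : Measure ℝ)
    [IsProbabilityMeasure μ] :
    MeasurePreserving (Function.swap : (ι → κ → ℝ) → κ → ι → ℝ)
      (Measure.pi fun _ => Measure.pi fun _ => μ) (Measure.pi fun _ => Measure.pi fun _ => μ) := by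
  have hp := measurePreserving_piCongrLeft (α := fun _ : κ × ι => ℝ) (fun _ => μ)
    (Equiv.prodComm ι κ)
  exact ((measurePreserving_curry_pi μ).comp hp).comp (measurePreserving_curry_pi μ).symm

lemma measurePreserving_orthonormalBasis_gaussianMatrix {ι n κ : Type*} [Fintype ι] [Fintype n]
    [Fintype κ] (b : OrthonormalBasis ι ℝ (EuclideanSpace ℝ n)) :
    MeasurePreserving (fun (W : ι → κ → ℝ) (a : n) (c : κ) => ∑ i, W i c * b i a)
      (Measure.pi fun _ => gaussianPi κ) (Measure.pi fun _ => gaussianPi κ) := by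
  have h := measurePreserving_pi (fun _ : κ => gaussianPi ι) (fun _ : κ => gaussianPi n)
    (fun _ => measurePreserving_orthonormalBasis_gaussianPi b)
  exact ((measurePreserving_swap_pi (ι := κ) (κ := n) _).comp h).comp
    (measurePreserving_swap_pi (ι := ι) (κ := κ) _)

lemma measurePreserving_orthonormalBasis_gaussianMatrix_prod {ι ι' n κ : Type*} [Fintype ι]
    [Fintype ι'] [Fintype n] [Fintype κ]
    (b : OrthonormalBasis (ι ⊕ ι') ℝ (EuclideanSpace ℝ n)) :
    MeasurePreserving
      (fun (W : (ι → κ → ℝ) × (ι' → κ → ℝ)) (a : n) (c : κ) =>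
        ∑ i, W.1 i c * b (.inl i) a + ∑ i, W.2 i c * b (.inr i) a)
      ((Measure.pi fun _ => gaussianPi κ).prod (Measure.pi fun _ => gaussianPi κ))
      (Measure.pi fun _ => gaussianPi κ) := by
  have h := (measurePreserving_orthonormalBasis_gaussianMatrix (κ := κ) b).comp
    (measurePreserving_sumPiEquivProdPi_symm (X := fun _ : ι ⊕ ι' => κ → ℝ)
      (fun _ => gaussianPi κ))
  convert h using 1
  ext W a c
  simp [Fintype.sum_sum_type, MeasurableEquiv.sumPiEquivProdPi, Equiv.sumPiEquivProdPi]

lemma lintegral_sq_sum_gaussianMatrix {ι κ : Type*} [Fintype ι] [Fintype κ]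
    (c : ι → ℝ) (t : κ → ℝ) :
    ∫⁻ W : ι → κ → ℝ, ENNReal.ofReal ((∑ i, c i * ∑ j, W i j * t j) ^ 2)
        ∂(Measure.pi fun _ => gaussianPi κ) =
      ENNReal.ofReal ((∑ i, c i ^ 2) * ∑ j, t j ^ 2) := by
  have hid : MemLp (fun x : ℝ => x) 2 (gaussianReal 0 1) := memLp_id_gaussianReal 2
  have hrow : ∀ s : κ → ℝ, MemLp (fun w : κ → ℝ => ∑ j, w j * s j) 2 (gaussianPi κ) := fun s =>
    memLp_finsetSum _ fun j _ =>
      (hid.comp_measurePreserving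
        (measurePreserving_eval (fun _ : κ => gaussianReal 0 1) j)).mul_const _
  have hmean : ∀ s : κ → ℝ, ∫ w : κ → ℝ, ∑ j, w j * s j ∂(gaussianPi κ) = 0 := by
    intro s
    rw [integral_finsetSum]
    · refine Finset.sum_eq_zero fun j _ => ?_
      rw [integral_mul_const, integral_eval]
      simp
    · exact fun j _ => ((hid.comp_measurePreserving
        (measurePreserving_eval (fun _ : κ => gaussianReal 0 1) j)).mul_const _).integrable (by simp)
  have hvrow : Var[fun w : κ → ℝ => ∑ j, w j * t j; gaussianPi κ] = ∑ j, t j ^ 2 := by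
    have := variance_sum_pi (μ := fun _ : κ => gaussianReal 0 1) (X := fun j x => x * t j)
      (fun j => hid.mul_const _)
    have e : (fun w : κ → ℝ => ∑ j, w j * t j) = ∑ j, fun w : κ → ℝ => w j * t j := by
      ext w; simp
    rw [e, this]
    refine Finset.sum_congr rfl fun j _ => ?_
    rw [variance_mul_const]
    simp
  have hterm : ∀ i, MemLp (fun w : κ → ℝ => c i * ∑ j, w j * t j) 2 (gaussianPi κ) := fun i =>
    (hrow t).const_mul _
  have hmem : MemLp (fun W : ι → κ → ℝ => ∑ i, c i * ∑ j, W i j * t j) 2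
      (Measure.pi fun _ => gaussianPi κ) :=
    memLp_finsetSum _ fun i _ => (hterm i).comp_measurePreserving
      (measurePreserving_eval (fun _ : ι => gaussianPi κ) i)
  have hvar : Var[fun W : ι → κ → ℝ => ∑ i, c i * ∑ j, W i j * t j;
      Measure.pi fun _ => gaussianPi κ] = (∑ i, c i ^ 2) * ∑ j, t j ^ 2 := by
    have := variance_sum_pi (μ := fun _ : ι => gaussianPi κ)
      (X := fun i w => c i * ∑ j, w j * t j) hterm
    have e : (fun W : ι → κ → ℝ => ∑ i, c i * ∑ j, W i j * t j) =
        ∑ i, fun W : ι → κ → ℝ => c i * ∑ j, W i j * t j := by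
      ext w; simp
    rw [e, this, Finset.sum_mul]
    refine Finset.sum_congr rfl fun i _ => ?_
    rw [variance_const_mul, hvrow]
  have hm0 : ∫ W : ι → κ → ℝ, ∑ i, c i * ∑ j, W i j * t j
      ∂(Measure.pi fun _ => gaussianPi κ) = 0 := by
    rw [integral_finsetSum]
    · refine Finset.sum_eq_zero fun i _ => ?_
      rw [integral_comp_eval (μ := fun _ : ι => gaussianPi κ)
        (f := fun w : κ → ℝ => c i * ∑ j, w j * t j) (hterm i).aestronglyMeasurable,
        integral_const_mul, hmean, mul_zero]
    · exact fun i _ => ((hterm i).comp_measurePreserving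
        (measurePreserving_eval (fun _ : ι => gaussianPi κ) i)).integrable (by simp)
  rw [← ofReal_integral_eq_lintegral_ofReal hmem.integrable_sq (.of_forall fun _ => sq_nonneg _),
    ← hvar, variance_of_integral_eq_zero hmem.aestronglyMeasurable.aemeasurable hm0]

lemma integral_exp_neg_mul_sq_gaussianReal {t : ℝ} (ht : 0 ≤ t) :
    ∫ x, Real.exp (-t * x ^ 2) ∂(gaussianReal 0 1) = (1 + 2 * t) ^ (-(1 / 2) : ℝ) := by
  rw [integral_gaussianReal_eq_integral_smul one_ne_zero]
  have e : ∀ x : ℝ, gaussianPDFReal 0 1 x • Real.exp (-t * x ^ 2) =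
      (√(2 * Real.pi))⁻¹ * Real.exp (-(t + 1 / 2) * x ^ 2) := by
    intro x
    simp only [gaussianPDFReal, smul_eq_mul, NNReal.coe_one, mul_one, sub_zero, mul_assoc,
      ← Real.exp_add]
    congr 2
    ring
  simp_rw [e]
  rw [integral_const_mul, integral_gaussian, ← Real.sqrt_inv, ← Real.sqrt_mul (by positivity),
    Real.rpow_neg (by positivity), ← Real.sqrt_eq_rpow, ← Real.sqrt_inv]
  congr 1
  have := Real.pi_pos
  field_simp
  ring

lemma lintegral_Ioi_exp_neg_mul {y : ℝ} (hy : 0 ≤ y) :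
    ∫⁻ t in Set.Ioi (0 : ℝ), ENNReal.ofReal (Real.exp (-t * y)) = (ENNReal.ofReal y)⁻¹ := by
  rcases hy.eq_or_lt with rfl | hy
  · simp
  · have h1 : ∀ t : ℝ, Real.exp (-t * y) = Real.exp (-y * t) := fun t => by ring_nf
    simp_rw [h1]
    rw [← ofReal_integral_eq_lintegral_ofReal (integrableOn_exp_mul_Ioi (by linarith) 0)
      (.of_forall fun _ => (Real.exp_pos _).le), integral_exp_mul_Ioi (by linarith),
      ← ENNReal.ofReal_inv_of_pos hy]
    simp

lemma lintegral_Ioi_one_add_two_mul_rpow {a : ℝ} (ha : 1 < a) :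
    ∫⁻ t in Set.Ioi (0 : ℝ), ENNReal.ofReal ((1 + 2 * t) ^ (-a)) =
      ENNReal.ofReal (1 / (2 * a - 2)) := by
  have hd : ∀ x ∈ Set.Ici (0 : ℝ),
      HasDerivAt (fun t : ℝ => -(1 + 2 * t) ^ (1 - a) / (2 * a - 2)) ((1 + 2 * x) ^ (-a)) x := by
    intro x hx
    have hx' : (0 : ℝ) ≤ x := hx
    have h1 : HasDerivAt (fun t : ℝ => 1 + 2 * t) 2 x := by
      simpa using ((hasDerivAt_id x).const_mul 2).const_add 1
    have h2 := ((h1.rpow_const (p := 1 - a) (.inl (by positivity))).neg.div_const (2 * a - 2))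
    convert! h2 using 1
    have : (2 * a - 2) ≠ 0 := by linarith
    rw [show 1 - a - 1 = -a by ring, eq_div_iff this]
    ring
  have hpos : ∀ x ∈ Set.Ioi (0 : ℝ), 0 ≤ (1 + 2 * x) ^ (-a) := by
    intro x hx
    have hx' : (0 : ℝ) < x := hx
    positivity
  have hlim : Filter.Tendsto (fun t : ℝ => -(1 + 2 * t) ^ (1 - a) / (2 * a - 2)) Filter.atTop
      (nhds 0) := by
    have h1 : Filter.Tendsto (fun t : ℝ => 1 + 2 * t) Filter.atTop Filter.atTop :=
      Filter.tendsto_atTop_add_const_left _ _ (Filter.tendsto_id.const_mul_atTop (by norm_num))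
    have h2 := (tendsto_rpow_neg_atTop (y := a - 1) (by linarith)).comp h1
    have h3 := h2.neg.div_const (2 * a - 2)
    simpa [Function.comp_def] using h3
  have h_int := integrableOn_Ioi_deriv_of_nonneg' hd hpos hlim
  rw [← ofReal_integral_eq_lintegral_ofReal h_int
    ((ae_restrict_iff' measurableSet_Ioi).2 (.of_forall hpos)),
    integral_Ioi_of_hasDerivAt_of_nonneg' hd hpos hlim]
  congr 1
  simp [neg_div]

lemma lintegral_inv_sum_sq_gaussianPi {ι : Type*} [Fintype ι] (s : Finset ι) (hs : 3 ≤ s.card) :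
    ∫⁻ x, (ENNReal.ofReal (∑ i ∈ s, x i ^ 2))⁻¹ ∂(gaussianPi ι) =
      ENNReal.ofReal (1 / ((s.card : ℝ) - 2)) := by
  classical
  have h1 : ∀ x : ι → ℝ, (ENNReal.ofReal (∑ i ∈ s, x i ^ 2))⁻¹ =
      ∫⁻ t in Set.Ioi (0 : ℝ), ENNReal.ofReal (Real.exp (-t * ∑ i ∈ s, x i ^ 2)) := fun x =>
    (lintegral_Ioi_exp_neg_mul (Finset.sum_nonneg fun _ _ => sq_nonneg _)).symm
  simp_rw [h1]
  rw [lintegral_lintegral_swap (by fun_prop)]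
  have h2 : ∀ t ∈ Set.Ioi (0 : ℝ),
      ∫⁻ x, ENNReal.ofReal (Real.exp (-t * ∑ i ∈ s, x i ^ 2)) ∂(gaussianPi ι) =
        ENNReal.ofReal ((1 + 2 * t) ^ (-((s.card : ℝ) / 2))) := by
    intro t ht
    have ht' : (0 : ℝ) < t := ht
    have hexp : ∀ x : ι → ℝ, Real.exp (-t * ∑ i ∈ s, x i ^ 2) =
        ∏ i, if i ∈ s then Real.exp (-t * x i ^ 2) else 1 := by
      intro x
      rw [Finset.mul_sum, Real.exp_sum, Finset.prod_ite_mem, Finset.univ_inter]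
    rw [← ofReal_integral_eq_lintegral_ofReal ?_ (.of_forall fun _ => (Real.exp_pos _).le)]
    · congr 1
      simp_rw [hexp]
      rw [integral_fintype_prod_eq_prod (μ := fun _ => gaussianReal 0 1)
        (f := fun i (x : ℝ) => if i ∈ s then Real.exp (-t * x ^ 2) else 1)]
      have h3 : ∀ i, ∫ x : ℝ, (if i ∈ s then Real.exp (-t * x ^ 2) else 1) ∂(gaussianReal 0 1) =
          if i ∈ s then (1 + 2 * t) ^ (-(1 / 2) : ℝ) else 1 := by
        intro i
        split_ifs
        · exact integral_exp_neg_mul_sq_gaussianReal ht'.le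
        · simp
      simp_rw [h3]
      rw [Finset.prod_ite_mem, Finset.univ_inter, Finset.prod_const, ← Real.rpow_mul_natCast
        (by positivity)]
      congr 1
      ring
    · refine Integrable.of_bound (C := 1)
        (Measurable.aestronglyMeasurable (by fun_prop)) (.of_forall fun x => ?_)
      rw [Real.norm_eq_abs, Real.abs_exp, Real.exp_le_one_iff]
      have : 0 ≤ ∑ i ∈ s, x i ^ 2 := Finset.sum_nonneg fun _ _ => sq_nonneg _
      nlinarith
  rw [setLIntegral_congr_fun measurableSet_Ioi h2, lintegral_Ioi_one_add_two_mul_rpow]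
  · congr 2
    ring
  · have : (3 : ℝ) ≤ s.card := by exact_mod_cast hs
    linarith

lemma Submodule.exists_orthonormalBasis_mem {E ι : Type*} [NormedAddCommGroup E]
    [InnerProductSpace ℝ E] [FiniteDimensional ℝ E] [Fintype ι]
    (hE : Module.finrank ℝ E = Fintype.card ι) (K : Submodule ℝ E) (s : Finset ι)
    (hs : s.card ≤ Module.finrank ℝ K) :
    ∃ b : OrthonormalBasis ι ℝ E, ∀ i ∈ s, b i ∈ K := by
  classical
  let u := stdOrthonormalBasis ℝ K
  let e : s ↪ Fin (Module.finrank ℝ K) :=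
    s.equivFin.toEmbedding.trans (Fin.castLEEmb hs)
  let v : ι → E := fun i => if h : i ∈ s then (u (e ⟨i, h⟩) : E) else 0
  have hv : Orthonormal ℝ ((s : Set ι).domRestrict v) := by
    have h1 : Orthonormal ℝ (fun i : s => ((u (e i) : K) : E)) :=
      (u.orthonormal.comp e e.injective).comp_linearIsometry K.subtypeₗᵢ
    convert! h1 using 1
    ext i
    have : (i : ι) ∈ s := i.2
    simp [v, Set.domRestrict, this]
  obtain ⟨b, hb⟩ := hv.exists_orthonormalBasis_extension_of_card_eq hE
  refine ⟨b, fun i hi => ?_⟩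
  rw [hb i hi]
  simp [v, hi]

/-- The inverse squared distance from `g` to the span of the rows of `G`. -/
noncomputable def invDistSq {ι κ : Type*} [Fintype ι] [Fintype κ] (g : κ → ℝ) (G : ι → κ → ℝ) :
    ENNReal :=
  ⨆ c : ι → ℝ, (ENNReal.ofReal (∑ a, (g a - ∑ j, c j * G j a) ^ 2))⁻¹

lemma measurable_invDistSq {α ι κ : Type*} [TopologicalSpace α] [MeasurableSpace α]
    [BorelSpace α] [Fintype ι] [Fintype κ] {g : α → κ → ℝ}
    {G : α → ι → κ → ℝ} (hg : Continuous g) (hG : Continuous G) :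
    Measurable fun x => invDistSq (g x) (G x) := by
  refine LowerSemicontinuous.measurable (lowerSemicontinuous_iSup fun c => ?_)
  refine Continuous.lowerSemicontinuous ?_
  exact (ENNReal.continuous_ofReal.comp (by fun_prop)).inv

lemma lintegral_invDistSq_le {ι κ : Type*} [Fintype ι] [Fintype κ] (G : ι → κ → ℝ) {q : ℕ}
    (hq : 3 ≤ q) (hcard : Fintype.card ι + q ≤ Fintype.card κ) :
    ∫⁻ g, invDistSq g G ∂(gaussianPi κ) ≤ ENNReal.ofReal (1 / ((q : ℝ) - 2)) := by
  let H : Submodule ℝ (EuclideanSpace ℝ κ) :=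
    Submodule.span ℝ (Set.range fun j => WithLp.toLp 2 (G j))
  have hH : Module.finrank ℝ H ≤ Fintype.card ι := finrank_range_le_card _
  have hsum := H.finrank_add_finrank_orthogonal
  rw [finrank_euclideanSpace] at hsum
  obtain ⟨s, -, hs⟩ := Finset.exists_subset_card_eq (s := (Finset.univ : Finset κ)) (n := q)
    (by rw [Finset.card_univ]; omega)
  obtain ⟨b, hb⟩ := Hᗮ.exists_orthonormalBasis_mem finrank_euclideanSpace s (by omega)
  rw [← (measurePreserving_orthonormalBasis_gaussianPi b).lintegral_comp
    (measurable_invDistSq (g := fun g => g) (G := fun _ => G) (by fun_prop) (by fun_prop)), ← hs,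
    ← lintegral_inv_sum_sq_gaussianPi s (by omega)]
  refine lintegral_mono fun x => iSup_le fun c => ?_
  refine ENNReal.inv_le_inv.2 (ENNReal.ofReal_le_ofReal ?_)
  let h : EuclideanSpace ℝ κ := ∑ j, c j • WithLp.toLp 2 (G j)
  have hh : h ∈ H := Submodule.sum_mem _ fun j _ =>
    H.smul_mem _ (Submodule.subset_span ⟨j, rfl⟩)
  let v : EuclideanSpace ℝ κ := ∑ i, x i • b i - h
  have hin : ∀ i ∈ s, inner ℝ (b i) v = x i := by
    intro i hi
    rw [inner_sub_right, b.orthonormal.inner_right_fintype,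
      Submodule.inner_left_of_mem_orthogonal hh (hb i hi), sub_zero]
  calc ∑ i ∈ s, x i ^ 2 = ∑ i ∈ s, inner ℝ (b i) v ^ 2 :=
        Finset.sum_congr rfl fun i hi => by rw [hin i hi]
    _ ≤ ∑ i, inner ℝ (b i) v ^ 2 :=
        Finset.sum_le_sum_of_subset_of_nonneg (Finset.subset_univ _) fun _ _ _ => sq_nonneg _
    _ = ‖v‖ ^ 2 := b.sum_sq_inner_right v
    _ = _ := by
        rw [EuclideanSpace.real_norm_sq_eq]
        simp [v, h]

lemma lintegral_sum_invDistSq_le {k : ℕ} {κ : Type*} [Fintype κ] {q : ℕ}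
    (hq : 3 ≤ q) (hcard : k + q ≤ Fintype.card κ) :
    ∫⁻ G : Fin (k + 1) → κ → ℝ, ∑ i, invDistSq (G i) (fun j => G (i.succAbove j))
      ∂(Measure.pi fun _ => gaussianPi κ) ≤ ENNReal.ofReal ((k + 1 : ℕ) / ((q : ℝ) - 2)) := by
  have hq' : (3 : ℝ) ≤ q := by exact_mod_cast hq
  rw [lintegral_finsetSum _ fun i _ => measurable_invDistSq (by fun_prop) (by fun_prop)]
  have hi : ∀ i : Fin (k + 1), ∫⁻ G : Fin (k + 1) → κ → ℝ,
      invDistSq (G i) (fun j => G (i.succAbove j)) ∂(Measure.pi fun _ => gaussianPi κ) ≤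
        ENNReal.ofReal (1 / ((q : ℝ) - 2)) := by
    intro i
    have hmp := measurePreserving_piFinSuccAbove (fun _ : Fin (k + 1) => gaussianPi κ) i
    have hmeas : Measurable fun z : (κ → ℝ) × (Fin k → κ → ℝ) => invDistSq z.1 z.2 :=
      measurable_invDistSq continuous_fst continuous_snd
    have := hmp.lintegral_comp hmeas
    refine this.trans_le ?_
    rw [lintegral_prod_symm _ hmeas.aemeasurable]
    refine (lintegral_mono fun G => lintegral_invDistSq_le G hq (by simpa using hcard)).trans ?_
    simp
  refine (Finset.sum_le_sum fun i _ => hi i).trans ?_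
  rw [Finset.sum_const, Finset.card_univ, Fintype.card_fin, nsmul_eq_mul,
    ← ENNReal.ofReal_natCast, ← ENNReal.ofReal_mul (by positivity)]
  simp [div_eq_mul_inv]

lemma exists_dual_vector_of_invDistSq_ne_top {ι κ : Type*} [Fintype ι] [Fintype κ] {g : κ → ℝ}
    {G : ι → κ → ℝ} (h : invDistSq g G ≠ ⊤) :
    ∃ t : κ → ℝ, ∑ a, g a * t a = 1 ∧ (∀ j, ∑ a, G j a * t a = 0) ∧
      ENNReal.ofReal (∑ a, t a ^ 2) ≤ invDistSq g G := by
  let H : Submodule ℝ (EuclideanSpace ℝ κ) :=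
    Submodule.span ℝ (Set.range fun j => WithLp.toLp 2 (G j))
  let g' : EuclideanSpace ℝ κ := WithLp.toLp 2 g
  obtain ⟨c, hc⟩ := (Submodule.mem_span_range_iff_exists_fun ℝ).1 (H.starProjection_apply_mem g')
  let w : EuclideanSpace ℝ κ := g' - H.starProjection g'
  have hw : w ∈ Hᗮ := H.sub_starProjection_mem_orthogonal g'
  have hnorm : ‖w‖ ^ 2 = ∑ a, (g a - ∑ j, c j * G j a) ^ 2 := by
    rw [EuclideanSpace.real_norm_sq_eq]
    simp [w, ← hc, g']
  have hle : (ENNReal.ofReal (‖w‖ ^ 2))⁻¹ ≤ invDistSq g G := by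
    rw [hnorm]
    exact le_iSup (fun c : ι → ℝ => (ENNReal.ofReal (∑ a, (g a - ∑ j, c j * G j a) ^ 2))⁻¹) c
  have hpos : 0 < ‖w‖ ^ 2 := by
    by_contra hcon
    rw [ENNReal.ofReal_of_nonpos (not_lt.1 hcon), ENNReal.inv_zero, top_le_iff] at hle
    exact h hle
  have hin : ∀ x : EuclideanSpace ℝ κ, inner ℝ x w = ∑ a, x a * w a := by
    intro x
    simp [PiLp.inner_apply, mul_comm]
  refine ⟨fun a => w a / ‖w‖ ^ 2, ?_, fun j => ?_, ?_⟩
  · have h1 : inner ℝ g' w = ‖w‖ ^ 2 := by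
      have : g' = w + H.starProjection g' := by simp [w]
      rw [this, inner_add_left, Submodule.inner_right_of_mem_orthogonal
        (H.starProjection_apply_mem g') hw, real_inner_self_eq_norm_sq, add_zero]
    rw [hin] at h1
    simp_rw [← mul_div_assoc]
    rw [← Finset.sum_div, div_eq_one_iff_eq hpos.ne']
    exact h1
  · have hj : WithLp.toLp 2 (G j) ∈ H := Submodule.subset_span ⟨j, rfl⟩
    have h1 := Submodule.inner_right_of_mem_orthogonal hj hw
    rw [hin] at h1
    simp_rw [← mul_div_assoc]
    rw [← Finset.sum_div]
    exact div_eq_zero_iff.2 (.inl h1)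
  · refine le_trans (le_of_eq ?_) hle
    rw [← ENNReal.ofReal_inv_of_pos hpos]
    congr 1
    simp_rw [div_pow]
    rw [← Finset.sum_div, ← EuclideanSpace.real_norm_sq_eq]
    field_simp

lemma frobSq_nonneg {m n : Type*} [Fintype m] [Fintype n] (A : Matrix m n ℝ) : 0 ≤ frobSq A :=
  Finset.sum_nonneg fun _ _ => Finset.sum_nonneg fun _ _ => sq_nonneg _

lemma frobSqErrIn_nonneg {m n r : Type*} [Fintype m] [Fintype n] [Fintype r]
    (A : Matrix m n ℝ) (C : Matrix m r ℝ) (k : ℕ) : 0 ≤ frobSqErrIn A C k := by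
  refine Real.sInf_nonneg ?_
  rintro _ ⟨X, -, -, rfl⟩
  exact frobSq_nonneg _

lemma frobSqErrIn_le {m n r : Type*} [Fintype m] [Fintype n] [Fintype r]
    {A : Matrix m n ℝ} {C : Matrix m r ℝ} {k : ℕ} {X : Matrix m n ℝ} (hX : X.rank ≤ k)
    (hXC : LinearMap.range X.mulVecLin ≤ LinearMap.range C.mulVecLin) :
    frobSqErrIn A C k ≤ frobSq (A - X) := by
  refine csInf_le ⟨0, ?_⟩ ⟨X, hX, hXC, rfl⟩
  rintro _ ⟨X, -, -, rfl⟩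
  exact frobSq_nonneg _

lemma OrthonormalBasis.sum_mul_eq_ite {ι n : Type*} [Fintype ι] [DecidableEq ι] [Fintype n]
    (b : OrthonormalBasis ι ℝ (EuclideanSpace ℝ n)) (i j : ι) :
    ∑ c, b i c * b j c = if i = j then 1 else 0 := by
  rw [← b.inner_eq_ite i j]
  simp [PiLp.inner_apply, mul_comm]

lemma frobSq_eq_sum_orthonormalBasis {m n ι : Type*} [Fintype m] [Fintype n] [Fintype ι]
    (M : Matrix m n ℝ) (b : OrthonormalBasis ι ℝ (EuclideanSpace ℝ n)) :
    frobSq M = ∑ a, ∑ i, (∑ c, M a c * b i c) ^ 2 := by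
  refine Finset.sum_congr rfl fun a _ => ?_
  have h := b.sum_sq_inner_right (WithLp.toLp 2 (M a))
  rw [EuclideanSpace.real_norm_sq_eq] at h
  simpa [PiLp.inner_apply] using h.symm

/-- The rotation of the Gaussian matrix with row blocks `W₁`, `W₂` into the basis `b`. -/
noncomputable def rotatedRows {ι ι' n κ : Type*} [Fintype ι] [Fintype ι'] [Fintype n]
    (b : OrthonormalBasis (ι ⊕ ι') ℝ (EuclideanSpace ℝ n)) (W₁ : ι → κ → ℝ) (W₂ : ι' → κ → ℝ)
    (a : n) (c : κ) : ℝ :=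
  ∑ i, W₁ i c * b (.inl i) a + ∑ i, W₂ i c * b (.inr i) a

lemma frobSqErrIn_rotatedRows_le {m n ι ι' κ : Type*} [Fintype m] [Fintype n] [Fintype ι]
    [DecidableEq ι] [Fintype ι'] [Fintype κ] (A : Matrix m n ℝ)
    (b : OrthonormalBasis (ι ⊕ ι') ℝ (EuclideanSpace ℝ n)) (W₁ : ι → κ → ℝ) (W₂ : ι' → κ → ℝ)
    (T : ι → κ → ℝ) (hT : ∀ i j, ∑ s, W₁ j s * T i s = if j = i then 1 else 0) :
    frobSqErrIn A (A * Matrix.of (rotatedRows b W₁ W₂)) (Fintype.card ι) ≤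
      ∑ a, ∑ i, (∑ c, A a c * b (.inr i) c) ^ 2 +
        ∑ a, ∑ i, (∑ j, (∑ c, A a c * b (.inr j) c) * ∑ s, W₂ j s * T i s) ^ 2 := by
  classical
  let Y := A * Matrix.of (rotatedRows b W₁ W₂)
  let P : Matrix ι n ℝ := Matrix.of fun i c => b (.inl i) c
  let Z : Matrix m ι ℝ := Y * (Matrix.of T)ᵀ
  have hrank : (Z * P).rank ≤ Fintype.card ι :=
    (Matrix.rank_mul_le_right _ _).trans (Matrix.rank_le_card_height P)
  have hrange : LinearMap.range (Z * P).mulVecLin ≤ LinearMap.range Y.mulVecLin := by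
    rw [Matrix.mul_assoc, Matrix.mulVecLin_mul]
    exact LinearMap.range_comp_le_range _ _
  refine (frobSqErrIn_le hrank hrange).trans_eq ?_
  rw [frobSq_eq_sum_orthonormalBasis _ b, ← Finset.sum_add_distrib]
  refine Finset.sum_congr rfl fun a _ => ?_
  have hZP : ∀ i : ι ⊕ ι', ∑ c, (Z * P) a c * b i c = ∑ j, Z a j * ∑ c, b (.inl j) c * b i c := by
    intro i
    simp_rw [Matrix.mul_apply, Finset.sum_mul, Finset.mul_sum]
    rw [Finset.sum_comm]
    simp [P, mul_assoc]
  have hZ : ∀ i, Z a i = ∑ c, A a c * b (.inl i) c +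
      ∑ j, (∑ c, A a c * b (.inr j) c) * ∑ s, W₂ j s * T i s := by
    intro i
    have h1 : Z a i = ∑ c, A a c * ∑ s, rotatedRows b W₁ W₂ c s * T i s := by
      simp only [Z, Y, Matrix.mul_apply, Matrix.transpose_apply, Matrix.of_apply, Finset.sum_mul,
        Finset.mul_sum]
      rw [Finset.sum_comm]
      simp only [mul_assoc]
    have h2 : ∀ c, ∑ s, rotatedRows b W₁ W₂ c s * T i s =
        b (.inl i) c + ∑ j, b (.inr j) c * ∑ s, W₂ j s * T i s := by
      intro c
      have h3 : ∑ s, rotatedRows b W₁ W₂ c s * T i s =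
          ∑ j, b (.inl j) c * ∑ s, W₁ j s * T i s + ∑ j, b (.inr j) c * ∑ s, W₂ j s * T i s := by
        simp only [rotatedRows, add_mul, Finset.sum_add_distrib, Finset.sum_mul, Finset.mul_sum]
        congr 1 <;> rw [Finset.sum_comm] <;>
          exact Finset.sum_congr rfl fun _ _ => Finset.sum_congr rfl fun _ _ => by ring
      rw [h3]
      simp [hT]
    rw [h1]
    simp only [h2, mul_add, Finset.sum_add_distrib]
    congr 1
    simp only [Finset.mul_sum, Finset.sum_mul]
    rw [Finset.sum_comm]
    refine Finset.sum_congr rfl fun _ _ => ?_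
    rw [Finset.sum_comm]
    exact Finset.sum_congr rfl fun _ _ => Finset.sum_congr rfl fun _ _ => by ring
  simp only [Matrix.sub_apply, sub_mul, Finset.sum_sub_distrib, hZP, b.sum_mul_eq_ite,
    Fintype.sum_sum_type]
  rw [add_comm]
  congr 1
  · simp
  · refine Finset.sum_congr rfl fun i _ => ?_
    simp [hZ]

lemma exists_dual_family_of_sum_invDistSq_ne_top {k : ℕ} {κ : Type*} [Fintype κ]
    {G : Fin (k + 1) → κ → ℝ} (h : ∑ i, invDistSq (G i) (fun j => G (i.succAbove j)) ≠ ⊤) :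
    ∃ T : Fin (k + 1) → κ → ℝ, (∀ i j, ∑ s, G j s * T i s = if j = i then 1 else 0) ∧
      ∀ i, ENNReal.ofReal (∑ s, T i s ^ 2) ≤ invDistSq (G i) (fun j => G (i.succAbove j)) := by
  rw [ENNReal.sum_ne_top] at h
  choose T h1 h0 hT using fun i => exists_dual_vector_of_invDistSq_ne_top (h i (Finset.mem_univ i))
  refine ⟨T, fun i j => ?_, hT⟩
  obtain rfl | ⟨j, rfl⟩ := i.eq_self_or_eq_succAbove j
  · simpa using h1 j
  · simpa [Fin.succAbove_ne] using h0 i j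

lemma lintegral_frobSqErrIn_rotatedRows_le {m n ι' κ : Type*} [Fintype m] [Fintype n]
    [Fintype ι'] [Fintype κ] {k : ℕ} (A : Matrix m n ℝ)
    (b : OrthonormalBasis (Fin (k + 1) ⊕ ι') ℝ (EuclideanSpace ℝ n)) (W₁ : Fin (k + 1) → κ → ℝ)
    (h : ∑ i, invDistSq (W₁ i) (fun j => W₁ (i.succAbove j)) ≠ ⊤) :
    ∫⁻ W₂ : ι' → κ → ℝ, ENNReal.ofReal
        (frobSqErrIn A (A * Matrix.of (rotatedRows b W₁ W₂)) (k + 1))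
        ∂(Measure.pi fun _ => gaussianPi κ) ≤
      ENNReal.ofReal (∑ a, ∑ i, (∑ c, A a c * b (.inr i) c) ^ 2) *
        (1 + ∑ i, invDistSq (W₁ i) (fun j => W₁ (i.succAbove j))) := by
  obtain ⟨T, hT, hTle⟩ := exists_dual_family_of_sum_invDistSq_ne_top h
  set C : m → ι' → ℝ := fun a i => ∑ c, A a c * b (.inr i) c with hC
  have hτ : ∀ a, 0 ≤ ∑ i, C a i ^ 2 := fun a => Finset.sum_nonneg fun _ _ => sq_nonneg _
  calc _ ≤ ∫⁻ W₂ : ι' → κ → ℝ, (ENNReal.ofReal (∑ a, ∑ i, C a i ^ 2) +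
          ∑ a, ∑ i, ENNReal.ofReal ((∑ j, C a j * ∑ s, W₂ j s * T i s) ^ 2))
          ∂(Measure.pi fun _ => gaussianPi κ) := by
        refine lintegral_mono fun W₂ => ?_
        have h1 := frobSqErrIn_rotatedRows_le A b W₁ W₂ T hT
        rw [Fintype.card_fin] at h1
        refine (ENNReal.ofReal_le_ofReal h1).trans (ENNReal.ofReal_add_le.trans_eq ?_)
        congr 1
        rw [ENNReal.ofReal_sum_of_nonneg fun _ _ => Finset.sum_nonneg fun _ _ => sq_nonneg _]
        exact Finset.sum_congr rfl fun a _ =>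
          ENNReal.ofReal_sum_of_nonneg fun _ _ => sq_nonneg _
    _ = ENNReal.ofReal (∑ a, ∑ i, C a i ^ 2) +
          ∑ a, ∑ i, ENNReal.ofReal ((∑ j, C a j ^ 2) * ∑ s, T i s ^ 2) := by
        rw [lintegral_add_left measurable_const, lintegral_const, measure_univ, mul_one,
          lintegral_finsetSum _ fun _ _ => by fun_prop]
        congr 1
        refine Finset.sum_congr rfl fun a _ => ?_
        rw [lintegral_finsetSum _ fun _ _ => by fun_prop]
        exact Finset.sum_congr rfl fun i _ => lintegral_sq_sum_gaussianMatrix (C a) (T i)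
    _ = ENNReal.ofReal (∑ a, ∑ i, C a i ^ 2) * (1 + ∑ i, ENNReal.ofReal (∑ s, T i s ^ 2)) := by
        rw [mul_add, mul_one, ENNReal.ofReal_sum_of_nonneg fun a _ => hτ a, Finset.sum_mul]
        congr 1
        refine Finset.sum_congr rfl fun a _ => ?_
        rw [Finset.mul_sum]
        exact Finset.sum_congr rfl fun i _ => ENNReal.ofReal_mul (hτ a)
    _ ≤ _ := by
        gcongr with i
        exact hTle i

lemma lintegral_frobSqErrIn_gaussianMatrix_le {m n ι' κ : Type*} [Fintype m] [Fintype n]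
    [Fintype ι'] [Fintype κ] {k p : ℕ} (hp : 2 ≤ p) (hcard : k + 1 + p ≤ Fintype.card κ)
    (A : Matrix m n ℝ) (b : OrthonormalBasis (Fin (k + 1) ⊕ ι') ℝ (EuclideanSpace ℝ n)) :
    ∫⁻ R : n → κ → ℝ, ENNReal.ofReal (frobSqErrIn A (A * Matrix.of R) (k + 1))
        ∂(Measure.pi fun _ => gaussianPi κ) ≤
      ENNReal.ofReal ((1 + (k + 1 : ℕ) / ((p : ℝ) - 1)) *
        ∑ a, ∑ i, (∑ c, A a c * b (.inr i) c) ^ 2) := by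
  set τ := ∑ a, ∑ i, (∑ c, A a c * b (.inr i) c) ^ 2
  have hp' : (2 : ℝ) ≤ p := by exact_mod_cast hp
  have hD : Measurable fun W : Fin (k + 1) → κ → ℝ =>
      ∑ i, invDistSq (W i) (fun j => W (i.succAbove j)) :=
    Finset.measurable_fun_sum _ fun i _ => measurable_invDistSq (by fun_prop) (by fun_prop)
  have hle := lintegral_sum_invDistSq_le (κ := κ) (k := k) (q := p + 1) (by omega) (by omega)
  rw [show ((p + 1 : ℕ) : ℝ) - 2 = p - 1 by push_cast; ring] at hle
  rw [← (measurePreserving_orthonormalBasis_gaussianMatrix_prod (κ := κ) b).map_eq]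
  refine (lintegral_map_le _ _).trans ((lintegral_prod_le _).trans ?_)
  calc _ ≤ ∫⁻ W : Fin (k + 1) → κ → ℝ, ENNReal.ofReal τ *
          (1 + ∑ i, invDistSq (W i) (fun j => W (i.succAbove j)))
          ∂(Measure.pi fun _ => gaussianPi κ) := by
        refine lintegral_mono_ae ?_
        filter_upwards [ae_lt_top hD (hle.trans_lt ENNReal.ofReal_lt_top).ne] with W hW
        exact lintegral_frobSqErrIn_rotatedRows_le A b W hW.ne
    _ = ENNReal.ofReal τ * (1 + ∫⁻ W : Fin (k + 1) → κ → ℝ,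
          ∑ i, invDistSq (W i) (fun j => W (i.succAbove j))
          ∂(Measure.pi fun _ => gaussianPi κ)) := by
        rw [lintegral_const_mul _ (by fun_prop), lintegral_add_left measurable_const,
          lintegral_const, measure_univ, mul_one]
    _ ≤ ENNReal.ofReal τ * (1 + ENNReal.ofReal ((k + 1 : ℕ) / ((p : ℝ) - 1))) := by gcongr
    _ = _ := by
        have h0 : 0 ≤ ((k + 1 : ℕ) : ℝ) / ((p : ℝ) - 1) :=
          div_nonneg (Nat.cast_nonneg _) (by linarith)
        rw [mul_comm, ENNReal.ofReal_mul (by linarith), ENNReal.ofReal_add zero_le_one h0,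
          ENNReal.ofReal_one]

lemma exists_orthonormalBasis_sum_sq_le_frobSq_sub {m : Type*} [Fintype m] {n k l : ℕ}
    (hn : n = k + l) (A B : Matrix m (Fin n) ℝ) (hB : B.rank ≤ k) :
    ∃ b : OrthonormalBasis (Fin k ⊕ Fin l) ℝ (EuclideanSpace ℝ (Fin n)),
      ∑ a, ∑ i, (∑ c, A a c * b (.inr i) c) ^ 2 ≤ frobSq (A - B) := by
  classical
  let f : EuclideanSpace ℝ (Fin n) →ₗ[ℝ] m → ℝ :=
    B.mulVecLin ∘ₗ (WithLp.linearEquiv 2 ℝ (Fin n → ℝ)).toLinearMap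
  have hf : Module.finrank ℝ (LinearMap.range f) = B.rank := by
    rw [LinearMap.range_comp_of_range_eq_top _ (LinearEquiv.range _)]
    rfl
  have hker := f.finrank_range_add_finrank_ker
  rw [finrank_euclideanSpace, Fintype.card_fin] at hker
  obtain ⟨b, hb⟩ := (LinearMap.ker f).exists_orthonormalBasis_mem (ι := Fin k ⊕ Fin l)
    (by simp [hn]) (Finset.univ.map .inr) (by simp; omega)
  refine ⟨b, ?_⟩
  rw [frobSq_eq_sum_orthonormalBasis _ b]
  refine Finset.sum_le_sum fun a _ => ?_
  rw [Fintype.sum_sum_type]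
  refine le_add_of_nonneg_of_le (Finset.sum_nonneg fun _ _ => sq_nonneg _)
    (Finset.sum_le_sum fun i _ => le_of_eq ?_)
  have h0 : ∑ c, B a c * b (.inr i) c = 0 := congrFun (hb (.inr i) (by simp)) a
  simp [sub_mul, h0]

/-- **Randomized fast Frobenius norm SVD** (Lemma 6.1 of
Boutsidis–Drineas–Magdon-Ismail, extending Theorem 10.5 of Halko–Martinsson–Tropp): let
`A ∈ ℝ^{m×n}` have rank `ρ`, let `2 ≤ k < ρ`, `p ≥ 2`, and `r = k + p`.  If `R` is an
`n × r` matrix with i.i.d. standard Gaussian entries and `Y = A R`, then the expected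
value of `min {‖A - X‖_F² : rank X ≤ k, col X ⊆ col Y}` is at most
`(1 + k/(p-1)) ‖A - A_k‖_F²`. -/
theorem fast_frobenius_svd
    {m n : ℕ} (A : Matrix (Fin m) (Fin n) ℝ) (k p r : ℕ)
    (hk2 : 2 ≤ k) (hk : k < A.rank) (hp : 2 ≤ p) (hr : r = k + p) :
    (∫ R : Fin n → Fin r → ℝ,
        sInf {e : ℝ | ∃ X : Matrix (Fin m) (Fin n) ℝ, X.rank ≤ k ∧
          LinearMap.range X.mulVecLin ≤
            LinearMap.range (A * Matrix.of R).mulVecLin ∧ e = frobSq (A - X)}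
      ∂(Measure.pi fun _ : Fin n =>
          Measure.pi fun _ : Fin r => ProbabilityTheory.gaussianReal 0 1)) ≤
    (1 + (k : ℝ) / ((p : ℝ) - 1)) * frobSqErr A k := by
  change ∫ R : Fin n → Fin r → ℝ, frobSqErrIn A (A * Matrix.of R) k
    ∂(Measure.pi fun _ => gaussianPi (Fin r)) ≤ _
  have hp' : (2 : ℝ) ≤ p := by exact_mod_cast hp
  have hK : 0 < 1 + (k : ℝ) / ((p : ℝ) - 1) :=
    add_pos_of_pos_of_nonneg one_pos (div_nonneg (Nat.cast_nonneg _) (by linarith))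
  rw [← div_le_iff₀' hK]
  refine le_csInf ⟨_, 0, by simp, rfl⟩ ?_
  rintro _ ⟨B, hB, rfl⟩
  rw [div_le_iff₀' hK]
  by_cases h_int : Integrable (fun R : Fin n → Fin r → ℝ => frobSqErrIn A (A * Matrix.of R) k)
    (Measure.pi fun _ => gaussianPi (Fin r))
  · obtain ⟨l, hl⟩ := Nat.exists_eq_add_of_le (hk.le.trans A.rank_le_width)
    obtain ⟨b, hb⟩ := exists_orthonormalBasis_sum_sq_le_frobSq_sub hl A B hB
    obtain ⟨k, rfl⟩ := Nat.exists_eq_add_of_le' (one_le_two.trans hk2)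
    refine (ENNReal.ofReal_le_ofReal_iff (mul_nonneg hK.le (frobSq_nonneg _))).1 ?_
    rw [ofReal_integral_eq_lintegral_ofReal h_int (.of_forall fun _ => frobSqErrIn_nonneg _ _ _)]
    refine (lintegral_frobSqErrIn_gaussianMatrix_le hp (by simp [hr]) A b).trans ?_
    gcongr
  · rw [integral_undef h_int]
    exact mul_nonneg hK.le (frobSq_nonneg _)
end
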